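/- Let G be a locally finite Borel graph on a standard Borel space X and let A ⊆ X be Borel. Then there is a one-ended Borel function f : [A]_{E_G} ∖ A → [A]_{E_G} whose graph is contained in G. -/

import Mathlib

open MeasureTheory

/-- A partial function `f : B → X` is *one-ended* if there is no infinite sequence
`x₀, x₁, x₂, …` of points of `B` with `f (x_{i+1}) = x_i` for all `i`. -/
def OneEnded {X : Type*} {B : Set X} (f : B → X) : Prop :=
  ¬ ∃ u : ℕ → B, ∀ i : ℕ, f (u (i + 1)) = (u i : X)

/-- A set of vertices is `G`-invariant if it is a union of connected components of `G`. -/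
def GraphInvariant {X : Type*} (G : SimpleGraph X) (A : Set X) : Prop :=
  ∀ ⦃x y : X⦄, G.Reachable x y → x ∈ A → y ∈ A

/-- `[A]_{E_G}`: the union of all connected components of `G` meeting `A`. -/
def EGSat {X : Type*} (G : SimpleGraph X) (A : Set X) : Set X :=
  {x | ∃ a ∈ A, G.Reachable x a}

/-- `S` is biconnected: the induced subgraph on `S` is connected and remains connected
(in the sense of `Preconnected`) after deleting any single vertex of `S`. -/
def BiconnectedSet {X : Type*} (G : SimpleGraph X) (S : Set X) : Prop :=
  (G.induce S).Connected ∧ ∀ x ∈ S, (G.induce (S \ {x})).Preconnected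

/-- A block of `G` is a maximal biconnected set. -/
def GraphBlock {X : Type*} (G : SimpleGraph X) (S : Set X) : Prop :=
  BiconnectedSet G S ∧ ∀ T : Set X, BiconnectedSet G T → S ⊆ T → T = S

/-- The induced subgraph on `S` is a cycle of odd length. -/
def OddCycleSet {X : Type*} (G : SimpleGraph X) (S : Set X) : Prop :=
  ∃ n : ℕ, Odd n ∧ 3 ≤ n ∧ Nonempty (G.induce S ≃g SimpleGraph.cycleGraph n)

/-- A Gallai tree is a connected graph each of whose blocks induces a complete
graph or an odd cycle. -/
def GallaiTree {X : Type*} (G : SimpleGraph X) : Prop :=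
  G.Connected ∧ ∀ S : Set X, GraphBlock G S → G.IsClique S ∨ OddCycleSet G S

/-- A graph is ample if every vertex has degree at least 2 and for every vertex `x`,
every connected component of the restriction of `G` to the complement of `{x}`
contains a vertex of degree at least 3 in that restriction. -/
def AmpleGraph {X : Type*} (G : SimpleGraph X) : Prop :=
  (∀ x : X, 2 ≤ (G.neighborSet x).encard) ∧
  ∀ x : X, ∀ y : ({x}ᶜ : Set X), ∃ z : ({x}ᶜ : Set X),
    (G.induce ({x}ᶜ : Set X)).Reachable y z ∧
      3 ≤ ((G.induce ({x}ᶜ : Set X)).neighborSet z).encard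

/-- `x E^even_G y`: `x` and `y` are joined by a path of even length in `G`. -/
def EvenRel {X : Type*} (G : SimpleGraph X) (x y : X) : Prop :=
  ∃ p : G.Walk x y, p.IsPath ∧ Even p.length

/-- A set is `E^even_G`-invariant if it is a union of `E^even_G`-classes. -/
def EvenInvariant {X : Type*} (G : SimpleGraph X) (C : Set X) : Prop :=
  ∀ ⦃x y : X⦄, EvenRel G x y → x ∈ C → y ∈ C


open Set Function Topology

/-- The sets `s n` are contained in measurable sets with empty intersection. -/
def JointlySeparable {α : Type*} [MeasurableSpace α] (s : ℕ → Set α) : Prop :=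
  ∃ B : ℕ → Set α, (∀ n, MeasurableSet (B n)) ∧ (∀ n, s n ⊆ B n) ∧ ⋂ n, B n = ∅

theorem JointlySeparable.of_iUnion {α : Type*} [MeasurableSpace α] {s : ℕ → Set α} {k : ℕ}
    (t : ℕ → ℕ → Set α) (hk : s k ⊆ ⋃ j, t j k) (hne : ∀ j, ∀ n ≠ k, s n ⊆ t j n)
    (h : ∀ j, JointlySeparable (t j)) : JointlySeparable s := by
  choose C hCm hCs hC using h
  refine ⟨fun n => if n = k then ⋃ j, C j k else ⋂ j, C j n, fun n => ?_, fun n => ?_, ?_⟩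
  · dsimp only
    split_ifs
    · exact MeasurableSet.iUnion fun j => hCm j k
    · exact MeasurableSet.iInter fun j => hCm j n
  · dsimp only
    split_ifs with hn
    · subst hn
      exact hk.trans (iUnion_mono fun j => hCs j n)
    · exact subset_iInter fun j => (hne j n hn).trans (hCs j n)
  · rw [eq_empty_iff_forall_notMem]
    intro z hz
    rw [mem_iInter] at hz
    have hzk := hz k
    simp only [if_true, mem_iUnion] at hzk
    obtain ⟨j, hj⟩ := hzk
    have : z ∈ ⋂ n, C j n := by
      rw [mem_iInter]
      intro n
      by_cases hn : n = k
      · exact hn ▸ hj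
      · have := hz n
        simp only [if_neg hn, mem_iInter] at this
        exact this j
    rw [hC j] at this
    exact this

theorem jointlySeparable_range {α : Type*} [TopologicalSpace α] [T2Space α] [MeasurableSpace α]
    [OpensMeasurableSpace α] {f : ℕ → (ℕ → ℕ) → α} (hf : ∀ n, Continuous (f n))
    (h : ⋂ n, range (f n) = ∅) : JointlySeparable fun n => range (f n) := by
  let S : (ℕ → ℕ) → ℕ → ℕ → Set α := fun p k n =>
    f n '' {x | ∀ i, Nat.pair n i < k → x i = p (Nat.pair n i)}
  have S_congr : ∀ p q k, (∀ i < k, p i = q i) → S p k = S q k := by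
    intro p q k hpq
    funext n
    simp only [S]
    congr 1
    ext x
    exact forall_congr' fun i => forall_congr' fun hi => by rw [hpq _ hi]
  by_contra hns
  have split : ∀ p k, ¬ JointlySeparable (S p k) →
      ∃ j, ¬ JointlySeparable (S (update p k j) (k + 1)) := by
    intro p k
    contrapose!
    intro H
    refine JointlySeparable.of_iUnion (k := k.unpair.1)
      (fun j => S (update p k j) (k + 1)) ?_ ?_ H
    · rintro _ ⟨x, hx, rfl⟩
      refine mem_iUnion.2 ⟨x k.unpair.2, x, fun i hi => ?_, rfl⟩
      rcases Nat.lt_succ_iff_lt_or_eq.1 hi with hi | hi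
      · rw [update_of_ne hi.ne, hx i hi]
      · have : i = k.unpair.2 := by rw [← hi, Nat.unpair_pair]
        rw [hi, update_self, this]
    · rintro j n hn _ ⟨x, hx, rfl⟩
      refine ⟨x, fun i hi => ?_, rfl⟩
      rcases Nat.lt_succ_iff_lt_or_eq.1 hi with hi | hi
      · rw [update_of_ne hi.ne, hx i hi]
      · exact absurd (by rw [← hi, Nat.unpair_pair]) hn
  choose J hJ using split
  let P : (k : ℕ) → {p : ℕ → ℕ // ¬ JointlySeparable (S p k)} := fun k =>
    Nat.rec ⟨0, by simpa [S] using hns⟩ (fun k p => ⟨update p.1 k (J p.1 k p.2), hJ p.1 k p.2⟩) k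
  let q : ℕ → ℕ := fun i => (P (i + 1)).1 i
  have hPq : ∀ k, ∀ i < k, (P k).1 i = q i := by
    intro k
    induction k with
    | zero => intro i hi; omega
    | succ k ih =>
      intro i hi
      rcases Nat.lt_succ_iff_lt_or_eq.1 hi with hi | rfl
      · rw [← ih i hi]
        exact update_of_ne hi.ne _ _
      · rfl
  have hq : ∀ k, ¬ JointlySeparable (S q k) := fun k =>
    S_congr _ _ k (hPq k) ▸ (P k).2
  let x : ℕ → ℕ → ℕ := fun n i => q (Nat.pair n i)
  have nhd : ∀ n, ∀ U : Set α, IsOpen U → f n (x n) ∈ U → ∃ K, ∀ k ≥ K, S q k n ⊆ U := by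
    intro n U hU hx
    obtain ⟨_, ⟨y, N, rfl⟩, hxy, hsub⟩ :=
      (PiNat.isTopologicalBasis_cylinders (fun _ : ℕ => ℕ)).mem_nhds_iff.1
        ((hf n).continuousAt.preimage_mem_nhds (hU.mem_nhds hx))
    refine ⟨Nat.pair n N, fun k hk => ?_⟩
    rintro _ ⟨z, hz, rfl⟩
    refine hsub fun i hi => ?_
    rw [hz i ((Nat.pair_lt_pair_right n hi).trans_le hk)]
    exact hxy i hi
  obtain ⟨n, hn⟩ : ∃ n, f n (x n) ≠ f 0 (x 0) := by
    by_contra! hall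
    have : f 0 (x 0) ∈ ⋂ n, range (f n) := mem_iInter.2 fun n => ⟨x n, hall n⟩
    rw [h] at this
    exact this
  obtain ⟨U, V, hU, hV, hxU, hxV, hUV⟩ := t2_separation hn
  obtain ⟨K, hK⟩ := nhd n U hU hxU
  obtain ⟨L, hL⟩ := nhd 0 V hV hxV
  have hn0 : n ≠ 0 := by rintro rfl; exact hn rfl
  refine hq (max K L) ⟨fun m => if m = n then U else if m = 0 then V else univ,
    fun m => ?_, fun m => ?_, ?_⟩
  · dsimp only
    split_ifs
    exacts [hU.measurableSet, hV.measurableSet, MeasurableSet.univ]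
  · dsimp only
    split_ifs with h1 h2
    · exact h1 ▸ hK _ (le_max_left _ _)
    · exact h2 ▸ hL _ (le_max_right _ _)
    · exact subset_univ _
  · rw [eq_empty_iff_forall_notMem]
    intro z hz
    rw [mem_iInter] at hz
    have h1 := hz n
    have h2 := hz 0
    simp only [if_true, if_neg hn0.symm] at h1 h2
    exact disjoint_left.1 hUV h1 h2

/-- **Novikov's separation theorem**: countably many analytic sets with empty intersection are
contained in Borel sets with empty intersection. -/
theorem jointlySeparable_of_analyticSet {α : Type*} [TopologicalSpace α] [T2Space α]
    [MeasurableSpace α] [OpensMeasurableSpace α] {s : ℕ → Set α} (hs : ∀ n, AnalyticSet (s n))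
    (h : ⋂ n, s n = ∅) : JointlySeparable s := by
  by_cases he : ∃ n, s n = ∅
  · obtain ⟨n, hn⟩ := he
    refine ⟨fun m => if m = n then ∅ else univ, fun m => ?_, fun m => ?_, ?_⟩
    · dsimp only
      split_ifs
      exacts [MeasurableSet.empty, MeasurableSet.univ]
    · dsimp only
      split_ifs with hm
      · rw [hm, hn]
      · exact subset_univ _
    · exact subset_empty_iff.1 ((iInter_subset _ n).trans (by simp))
  · push Not at he
    have : ∀ n, ∃ f : (ℕ → ℕ) → α, Continuous f ∧ range f = s n := fun n => by
      have := hs n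
      rw [AnalyticSet] at this
      exact this.resolve_left (he n).ne_empty
    choose f hf hfs using this
    have := jointlySeparable_range hf (by simpa only [hfs] using h)
    simpa only [hfs] using this

/-- A Borel relation with finite sections is a countable union of Borel partial functions. -/
theorem exists_iUnion_graphs_of_finite_sections {X : Type*} [MeasurableSpace X]
    [StandardBorelSpace X] {R : Set (X × X)} (hR : MeasurableSet R)
    (hfin : ∀ x, {y | (x, y) ∈ R}.Finite) :
    ∃ F : ℕ → Set (X × X), (∀ n, MeasurableSet (F n)) ∧ R = ⋃ n, F n ∧
      ∀ n x y z, (x, y) ∈ F n → (x, z) ∈ F n → y = z := by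
  let := upgradeStandardBorel X
  obtain ⟨U, hU⟩ := ((TopologicalSpace.countable_countableBasis X).insert ∅).exists_eq_range
    (insert_nonempty _ _)
  have hUm : ∀ n, MeasurableSet (U n) := fun n => by
    have : U n ∈ insert ∅ (TopologicalSpace.countableBasis X) := hU ▸ mem_range_self n
    rcases this with h | h
    · rw [h]; exact MeasurableSet.empty
    · exact (TopologicalSpace.isOpen_of_mem_countableBasis h).measurableSet
  let T : ℕ → Set ((X × X) × X × X) := fun n => {p | p.1 ∈ R ∧ (p.1.2 ∉ U n ∨
    ((p.1.1, p.2.1) ∈ R ∧ p.2.1 ∈ U n) ∧ ((p.1.1, p.2.2) ∈ R ∧ p.2.2 ∈ U n) ∧ p.2.1 ≠ p.2.2)}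
  have hT : ∀ n, MeasurableSet (T n) := fun n => by
    have m1 : Measurable fun p : (X × X) × X × X => (p.1.1, p.2.1) := by fun_prop
    have m2 : Measurable fun p : (X × X) × X × X => (p.1.1, p.2.2) := by fun_prop
    have m3 : Measurable fun p : (X × X) × X × X => p.1.2 := by fun_prop
    have m4 : Measurable fun p : (X × X) × X × X => p.2.1 := by fun_prop
    have m5 : Measurable fun p : (X × X) × X × X => p.2.2 := by fun_prop
    exact (measurable_fst hR).inter ((m3 (hUm n)).compl.union
      (((m1 hR).inter (m4 (hUm n))).inter (((m2 hR).inter (m5 (hUm n))).inter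
        (measurableSet_eq_fun m4 m5).compl)))
  obtain ⟨B, hBm, hBs, hB⟩ := jointlySeparable_of_analyticSet
    (s := fun n => Prod.fst '' T n) (fun n => (hT n).analyticSet_image measurable_fst) (by
      rw [eq_empty_iff_forall_notMem]
      rintro ⟨x, y⟩ hxy
      rw [mem_iInter] at hxy
      have hxyR : (x, y) ∈ R := by
        obtain ⟨⟨_, _⟩, hp, rfl⟩ := hxy 0
        exact hp.1
      have hop : IsOpen ({z | (x, z) ∈ R} \ {y})ᶜ :=
        ((hfin x).subset sdiff_subset).isClosed.isOpen_compl
      obtain ⟨V, hV, hyV, hVs⟩ := (TopologicalSpace.isBasis_countableBasis X).mem_nhds_iff.1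
        (hop.mem_nhds (show y ∈ ({z | (x, z) ∈ R} \ {y})ᶜ by simp))
      obtain ⟨n, rfl⟩ : V ∈ range U := hU ▸ mem_insert_of_mem _ hV
      obtain ⟨⟨_, y₁, y₂⟩, ⟨-, hp⟩, rfl⟩ := hxy n
      rcases hp with hp | ⟨⟨h1, h1'⟩, ⟨h2, h2'⟩, hne⟩
      · exact hp hyV
      · have e1 : y₁ = y := by
          by_contra hc
          exact hVs h1' ⟨h1, hc⟩
        have e2 : y₂ = y := by
          by_contra hc
          exact hVs h2' ⟨h2, hc⟩
        exact hne (e1.trans e2.symm))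
  refine ⟨fun n => R \ B n, fun n => hR.diff (hBm n), ?_, ?_⟩
  · rw [← sdiff_iInter, hB, sdiff_empty]
  · rintro n x y z ⟨hy, hyB⟩ ⟨hz, hzB⟩
    by_contra hne
    have hyU : y ∈ U n := by
      by_contra hc
      exact hyB (hBs n ⟨((x, y), y, y), ⟨hy, Or.inl hc⟩, rfl⟩)
    have hzU : z ∈ U n := by
      by_contra hc
      exact hzB (hBs n ⟨((x, z), z, z), ⟨hz, Or.inl hc⟩, rfl⟩)
    exact hyB (hBs n ⟨((x, y), y, z), ⟨hy, Or.inr ⟨⟨hy, hyU⟩, ⟨hz, hzU⟩, hne⟩⟩, rfl⟩)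

/-- **Lusin–Novikov uniformization** for relations with finite sections. -/
theorem exists_measurable_uniformization {X : Type*} [MeasurableSpace X]
    [StandardBorelSpace X] {R : Set (X × X)} (hR : MeasurableSet R)
    (hfin : ∀ x, {y | (x, y) ∈ R}.Finite) :
    MeasurableSet {x | ∃ y, (x, y) ∈ R} ∧
      ∃ h : X → X, Measurable h ∧ ∀ x, (∃ y, (x, y) ∈ R) → (x, h x) ∈ R := by
  classical
  obtain ⟨F, hFm, hRF, hF⟩ := exists_iUnion_graphs_of_finite_sections hR hfin
  have proj : ∀ n, ∀ C, MeasurableSet C → MeasurableSet {x | ∃ y ∈ C, (x, y) ∈ F n} := by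
    intro n C hC
    have : {x | ∃ y ∈ C, (x, y) ∈ F n} = Prod.fst '' (F n ∩ Prod.snd ⁻¹' C) := by
      ext x
      constructor
      · rintro ⟨y, hy, hxy⟩
        exact ⟨(x, y), ⟨hxy, hy⟩, rfl⟩
      · rintro ⟨⟨_, y⟩, ⟨hxy, hy⟩, rfl⟩
        exact ⟨y, hy, hxy⟩
    rw [this]
    refine ((hFm n).inter (measurable_snd hC)).image_of_measurable_injOn measurable_fst ?_
    rintro ⟨x, y⟩ ⟨hy, -⟩ ⟨x', z⟩ ⟨hz, -⟩ (rfl : x = x')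
    rw [hF n x y z hy hz]
  have dom : ∀ n, MeasurableSet {x | ∃ y, (x, y) ∈ F n} := fun n => by
    simpa using proj n univ MeasurableSet.univ
  have memR : ∀ x, (∃ y, (x, y) ∈ R) ↔ ∃ n y, (x, y) ∈ F n := fun x => by
    rw [hRF]
    simp only [mem_iUnion]
    exact exists_comm
  have hdomR : MeasurableSet {x | ∃ y, (x, y) ∈ R} := by
    simp only [memR, ofPred_exists]
    exact MeasurableSet.iUnion fun n => by simpa only [ofPred_exists] using dom n
  let g : ℕ → X → X := fun n x => if h : ∃ y, (x, y) ∈ F n then h.choose else x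
  have hgF : ∀ n x, (∃ y, (x, y) ∈ F n) → (x, g n x) ∈ F n := fun n x h => by
    simp only [g, dif_pos h]
    exact h.choose_spec
  have hg : ∀ n, Measurable (g n) := by
    intro n C hC
    have : g n ⁻¹' C = {x | ∃ y ∈ C, (x, y) ∈ F n} ∪ ({x | ∃ y, (x, y) ∈ F n}ᶜ ∩ C) := by
      ext x
      by_cases h : ∃ y, (x, y) ∈ F n
      · have h1 : (∃ y ∈ C, (x, y) ∈ F n) ↔ g n x ∈ C :=
          ⟨fun ⟨y, hy, hxy⟩ => hF n x y _ hxy (hgF n x h) ▸ hy, fun hx => ⟨_, hx, hgF n x h⟩⟩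
        simp [h1, h]
      · have h1 : ¬ ∃ y ∈ C, (x, y) ∈ F n := fun ⟨y, _, hy⟩ => h ⟨y, hy⟩
        have h2 : g n x = x := dif_neg h
        simp only [mem_preimage, h2, mem_union, mem_inter_iff, mem_compl_iff, mem_ofPred_eq, h, h1,
          not_false_eq_true, true_and, false_or]
    rw [this]
    exact (proj n C hC).union ((dom n).compl.inter hC)
  let Q : X → ℕ → Prop := fun x n => (∃ y, (x, y) ∈ F n) ∨ ¬ ∃ y, (x, y) ∈ R
  have hQ : ∀ x, ∃ n, Q x n := fun x => by
    by_cases h : ∃ y, (x, y) ∈ R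
    · obtain ⟨n, hn⟩ := (memR x).1 h
      exact ⟨n, Or.inl hn⟩
    · exact ⟨0, Or.inr h⟩
  have hQm : ∀ n, MeasurableSet {x | Q x n} := fun n => (dom n).union hdomR.compl
  refine ⟨hdomR, fun x => g (Nat.find (hQ x)) x, ?_, fun x hx => ?_⟩
  · exact Measurable.find hg hQm hQ
  · exact hRF.ge (mem_iUnion.2 ⟨_, hgF _ x ((Nat.find_spec (hQ x)).resolve_right (not_not.2 hx))⟩)

/-- The points having a backward orbit of length `n` under the restriction of `f` to `D`. -/
def backwardSet {X : Type*} (f : X → X) (D : Set X) : ℕ → Set X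
  | 0 => univ
  | n + 1 => {x | ∃ y ∈ D, f y = x ∧ y ∈ backwardSet f D n}

theorem backwardSet_antitone {X : Type*} (f : X → X) (D : Set X) :
    Antitone (backwardSet f D) := by
  refine antitone_nat_of_succ_le fun n => ?_
  induction n with
  | zero => exact subset_univ _
  | succ n ih =>
    rintro x ⟨y, hy, hyx, hyn⟩
    exact ⟨y, hy, hyx, ih hyn⟩

/-- A form of Kőnig's lemma. -/
theorem exists_mem_iInter_backwardSet {X : Type*} {f : X → X} {D : Set X} {x : X}
    (hfin : {y | y ∈ D ∧ f y = x}.Finite) (hx : x ∈ ⋂ n, backwardSet f D n) :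
    ∃ y ∈ D, f y = x ∧ y ∈ ⋂ n, backwardSet f D n := by
  rw [mem_iInter] at hx
  choose y hyD hyx hy using fun n => hx (n + 1)
  have := hfin.to_subtype
  obtain ⟨⟨z, hzD, hzx⟩, hz⟩ := Finite.exists_infinite_fiber
    (fun n => (⟨y n, hyD n, hyx n⟩ : {y | y ∈ D ∧ f y = x}))
  refine ⟨z, hzD, hzx, mem_iInter.2 fun n => ?_⟩
  obtain ⟨m, hm, hnm⟩ := (infinite_coe_iff.1 hz).exists_gt n
  have : y m = z := congrArg Subtype.val hm
  exact backwardSet_antitone f D hnm.le (this ▸ hy m)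

/-- The points joined to `A` by a walk of length at most `n`. -/
def closedNeighborhood {X : Type*} (G : SimpleGraph X) (A : Set X) : ℕ → Set X
  | 0 => A
  | n + 1 => closedNeighborhood G A n ∪ {x | ∃ y ∈ closedNeighborhood G A n, G.Adj x y}

theorem egSat_eq_iUnion {X : Type*} (G : SimpleGraph X) (A : Set X) :
    EGSat G A = ⋃ n, closedNeighborhood G A n := by
  ext x
  rw [mem_iUnion]
  constructor
  · rintro ⟨a, ha, ⟨w⟩⟩
    induction w with
    | nil => exact ⟨0, ha⟩
    | cons h _ ih =>
      obtain ⟨n, hn⟩ := ih ha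
      exact ⟨n + 1, Or.inr ⟨_, hn, h⟩⟩
  · rintro ⟨n, hn⟩
    induction n generalizing x with
    | zero => exact ⟨x, hn, .rfl⟩
    | succ n ih =>
      rcases hn with hn | ⟨y, hy, hxy⟩
      · exact ih x hn
      · obtain ⟨a, ha, hya⟩ := ih y hy
        exact ⟨a, ha, hxy.reachable.trans hya⟩

theorem stmt_9 {X : Type*} [MeasurableSpace X] [StandardBorelSpace X]
    (G : SimpleGraph X) (hGmeas : MeasurableSet {p : X × X | G.Adj p.1 p.2})
    (hlf : ∀ x : X, (G.neighborSet x).Finite)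
    (A : Set X) (hA : MeasurableSet A) :
    ∃ f : (EGSat G A \ A : Set X) → X, Measurable f ∧
      (∀ x : (EGSat G A \ A : Set X), f x ∈ EGSat G A ∧ G.Adj (x : X) (f x)) ∧
      OneEnded f := by
  classical
  have unif : ∀ S : Set (X × X), MeasurableSet S →
      MeasurableSet {x | ∃ y, G.Adj x y ∧ (x, y) ∈ S} ∧ ∃ h : X → X, Measurable h ∧
        ∀ x, (∃ y, G.Adj x y ∧ (x, y) ∈ S) → G.Adj x (h x) ∧ (x, h x) ∈ S := fun S hS =>
    exists_measurable_uniformization (hGmeas.inter hS) fun x => (hlf x).subset fun y hy => hy.1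
  have hNm : ∀ n, MeasurableSet (closedNeighborhood G A n) := fun n => by
    induction n with
    | zero => exact hA
    | succ n ih =>
      refine ih.union ?_
      have := (unif _ (measurable_snd ih)).1
      convert this using 5
      exact and_comm
  set E := EGSat G A with hE
  have hEN : ∀ x, x ∈ E ↔ ∃ n, x ∈ closedNeighborhood G A n := fun x => by
    rw [hE, egSat_eq_iUnion, mem_iUnion]
  have hEm : MeasurableSet E := by
    rw [hE, egSat_eq_iUnion]
    exact MeasurableSet.iUnion hNm
  have hEadj : ∀ x y, G.Adj x y → x ∈ E → y ∈ E := fun x y hxy ⟨a, ha, hxa⟩ =>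
    ⟨a, ha, hxy.symm.reachable.trans hxa⟩
  have hdex : ∀ x, ∃ n, x ∈ closedNeighborhood G A n ∨ x ∉ E := fun x => by
    by_cases hx : x ∈ E
    · obtain ⟨n, hn⟩ := (hEN x).1 hx
      exact ⟨n, Or.inl hn⟩
    · exact ⟨0, Or.inr hx⟩
  let d : X → ℕ := fun x => Nat.find (hdex x)
  have hdm : Measurable d := measurable_find hdex fun n => (hNm n).union hEm.compl
  obtain ⟨f₀, hf₀m, hf₀⟩ :=
    (unif {p | d p.2 < d p.1} (measurableSet_lt (by fun_prop) (by fun_prop))).2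
  replace hf₀ : ∀ x ∈ E \ A, G.Adj x (f₀ x) ∧ d (f₀ x) < d x := by
    rintro x ⟨hxE, hxA⟩
    refine hf₀ x ?_
    have hd : x ∈ closedNeighborhood G A (d x) :=
      (Nat.find_spec (hdex x)).resolve_right (not_not.2 hxE)
    rcases hk : d x with _ | k
    · rw [hk] at hd
      exact absurd hd hxA
    · rw [hk] at hd
      rcases hd with hd | ⟨y, hy, hxy⟩
      · exact absurd (Or.inl hd) (Nat.find_min (hdex x) (m := k) (by change k < d x; omega))
      · refine ⟨y, hxy, ?_⟩
        have : d y ≤ k := Nat.find_min' (hdex y) (Or.inl hy)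
        change d y < d x
        omega
  let W := ⋂ n, backwardSet f₀ (E \ A) n
  have hDm : MeasurableSet (E \ A) := hEm.diff hA
  have child : ∀ C, MeasurableSet C →
      MeasurableSet {p : X × X | p.2 ∈ E \ A ∧ f₀ p.2 = p.1 ∧ p.2 ∈ C} := fun C hC =>
    (measurable_snd hDm).inter ((measurableSet_eq_fun (hf₀m.comp measurable_snd)
      measurable_fst).inter (measurable_snd hC))
  have hBm : ∀ n, MeasurableSet (backwardSet f₀ (E \ A) n) := fun n => by
    induction n with
    | zero => exact MeasurableSet.univ
    | succ n ih =>
      convert (unif _ (child _ ih)).1 using 1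
      ext x
      refine exists_congr fun y => ?_
      constructor
      · rintro ⟨hy, hyx, hyn⟩
        exact ⟨hyx ▸ (hf₀ y hy).1.symm, hy, hyx, hyn⟩
      · exact fun h => h.2
  have hWm : MeasurableSet W := MeasurableSet.iInter hBm
  obtain ⟨h, hhm, hh⟩ := (unif _ (child W hWm)).2
  replace hh : ∀ x ∈ W, G.Adj x (h x) ∧ h x ∈ E \ A ∧ f₀ (h x) = x ∧ h x ∈ W := by
    intro x hx
    refine hh x ?_
    obtain ⟨y, hy, hyx, hyW⟩ := exists_mem_iInter_backwardSet
      ((hlf x).subset fun y hy => by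
        simpa only [hy.2] using! (hf₀ y hy.1).1.symm) hx
    exact ⟨y, hyx ▸ (hf₀ y hy).1.symm, hy, hyx, hyW⟩
  let F : X → X := fun x => if x ∈ W then h x else f₀ x
  have hF₁ : ∀ x ∈ W, F x = h x := fun x hx => if_pos hx
  have hF₂ : ∀ x ∉ W, F x = f₀ x := fun x hx => if_neg hx
  have hFadj : ∀ x ∈ E \ A, G.Adj x (F x) := fun x hx => by
    by_cases hW : x ∈ W
    · rw [hF₁ x hW]; exact (hh x hW).1
    · rw [hF₂ x hW]; exact (hf₀ x hx).1
  have hFm : Measurable F := Measurable.ite hWm hhm hf₀m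
  refine ⟨fun x => F x, hFm.comp measurable_subtype_coe,
    fun x => ⟨hEadj _ _ (hFadj x x.2) x.2.1, hFadj x x.2⟩, ?_⟩
  rintro ⟨u, hu⟩
  dsimp only at hu
  have hstep : ∀ i, (u (i + 1) : X) ∈ W → (u i : X) ∈ W := fun i hi => by
    rw [← hu i, hF₁ _ hi]
    exact (hh _ hi).2.2.2
  by_cases hall : ∀ i, (u i : X) ∈ W
  · have hdec : ∀ i, d (u (i + 1)) < d (u i) := fun i => by
      have h1 := (hh _ (hall (i + 1))).2.2.1
      rw [← hF₁ _ (hall (i + 1)), hu i] at h1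
      exact h1 ▸ (hf₀ _ (u i).2).2
    exact not_strictAnti_of_wellFoundedLT (fun i => d (u i)) (strictAnti_nat_of_succ_lt hdec)
  · push Not at hall
    obtain ⟨i, hi⟩ := hall
    have hnot : ∀ j, i ≤ j → (u j : X) ∉ W := fun j hj => by
      induction j, hj using Nat.le_induction with
      | base => exact hi
      | succ j _ ih => exact fun hc => ih (hstep j hc)
    have hback : ∀ n, ∀ j, i ≤ j → (u j : X) ∈ backwardSet f₀ (E \ A) n := fun n => by
      induction n with
      | zero => exact fun _ _ => mem_univ _
      | succ n ih =>
        intro j hj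
        refine ⟨u (j + 1), (u (j + 1)).2, ?_, ih _ (by omega)⟩
        rw [← hF₂ _ (hnot (j + 1) (by omega)), hu j]
    exact hi (mem_iInter.2 fun n => hback n i le_rfl)
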